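/- There exist absolute constants c, C ∈ ℝ_+ (the constants from the covering number lower and upper bounds for fully-connected ReLU networks with bounded weights) with the following property. Let p ∈ [1,∞], d ∈ ℕ, L, L̃, W, W̃ ∈ ℕ with W ≥ d, W̃ ≥ d, and W, L ≥ 60, and B, B̃ ∈ ℝ_+ with B, B̃ ≥ 1. If there exists ε ∈ (0, 1/8) such that A(R(d,W,L,B), R(d,W̃,L̃,B̃), ‖·‖_{L^p([0,1]^d)}) ≤ ε, then c · W²L · log((W+1)^L B^L / (4ε)) ≤ C · W̃² L̃ · log((W̃+1)^{L̃} B̃^{L̃} / ε). In particular, if R(d,W,L,B) ⊆ R(d,W̃,L̃,B̃), then C · W̃² L̃ ≥ c · W² L. -/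

import Mathlib

open MeasureTheory ProbabilityTheory ENNReal

noncomputable section

/-- A ReLU network configuration with input dimension `d`:
a finite sequence of matrix–vector pairs `(A_i, b_i)`, `i = 0, …, depth − 1`. -/
structure ReLUNet (d : ℕ) where
  depth : ℕ
  depth_pos : 0 < depth
  width : ℕ → ℕ
  width_in : width 0 = d
  width_out : width depth = 1
  A : ∀ i : ℕ, Matrix (Fin (width (i + 1))) (Fin (width i)) ℝ
  b : ∀ i : ℕ, Fin (width (i + 1)) → ℝ

namespace ReLUNet

variable {d : ℕ}

/-- The affine map `x ↦ A_i x + b_i` of layer `i`. -/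
def layer (Φ : ReLUNet d) (i : ℕ) (x : Fin (Φ.width i) → ℝ) :
    Fin (Φ.width (i + 1)) → ℝ :=
  fun j => (∑ k, Φ.A i j k * x k) + Φ.b i j

/-- Output after the first `i` affine layers, with the ReLU activation `ρ(x) = max{x,0}`
applied between consecutive affine layers (not on the input and not after the last
affine layer). -/
def forward (Φ : ReLUNet d) : (i : ℕ) → (Fin (Φ.width 0) → ℝ) → Fin (Φ.width i) → ℝ
  | 0, x => x
  | i + 1, x =>
      Φ.layer i fun k => if i = 0 then Φ.forward i x k else max (Φ.forward i x k) 0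

/-- The realization `R(Φ) : ℝ^d → ℝ` of a network configuration. -/
def realization (Φ : ReLUNet d) (x : Fin d → ℝ) : ℝ :=
  Φ.forward Φ.depth (fun k => x (Fin.cast Φ.width_in k)) (Fin.cast Φ.width_out.symm 0)

/-- All layer widths are at most `W`. -/
def widthLe (Φ : ReLUNet d) (W : ℕ) : Prop :=
  ∀ i ≤ Φ.depth, Φ.width i ≤ W

/-- All weights have absolute value at most `B`. -/
def magLe (Φ : ReLUNet d) (B : ℝ) : Prop :=
  ∀ i < Φ.depth, (∀ j k, |Φ.A i j k| ≤ B) ∧ ∀ j, |Φ.b i j| ≤ B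

/-- All weights take values in the set `𝔸`. -/
def coefIn (Φ : ReLUNet d) (𝔸 : Set ℝ) : Prop :=
  ∀ i < Φ.depth, (∀ j k, Φ.A i j k ∈ 𝔸) ∧ ∀ j, Φ.b i j ∈ 𝔸

open Classical in
/-- The connectivity (total number of nonzero weights) of a network configuration. -/
def connectivity (Φ : ReLUNet d) : ℕ :=
  ∑ i ∈ Finset.range Φ.depth,
    ((Finset.univ.filter fun jk : Fin (Φ.width (i + 1)) × Fin (Φ.width i) =>
        Φ.A i jk.1 jk.2 ≠ 0).card
      + (Finset.univ.filter fun j : Fin (Φ.width (i + 1)) => Φ.b i j ≠ 0).card)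

end ReLUNet

/-- `R(d,W,L,B)`: realizations of ReLU networks with input dimension `d`, output
dimension 1, width at most `W`, depth at most `L`, and weight magnitude at most `B`. -/
def RclassB (d W L : ℕ) (B : ℝ) : Set ((Fin d → ℝ) → ℝ) :=
  {f | ∃ Φ : ReLUNet d, Φ.widthLe W ∧ Φ.depth ≤ L ∧ Φ.magLe B ∧ Φ.realization = f}

/-- `R(d,W,L)`: realizations with width at most `W` and depth at most `L`,
with no constraint on the weight magnitude. -/
def Rclass (d W L : ℕ) : Set ((Fin d → ℝ) → ℝ) :=
  {f | ∃ Φ : ReLUNet d, Φ.widthLe W ∧ Φ.depth ≤ L ∧ Φ.realization = f}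

/-- `R_𝔸(d,W,L)`: realizations with width at most `W`, depth at most `L`, and all
weights taking values in `𝔸`. -/
def RclassCoef (d W L : ℕ) (𝔸 : Set ℝ) : Set ((Fin d → ℝ) → ℝ) :=
  {f | ∃ Φ : ReLUNet d, Φ.widthLe W ∧ Φ.depth ≤ L ∧ Φ.coefIn 𝔸 ∧ Φ.realization = f}

/-- `R(d,W,L,B,s)`: realizations with width ≤ `W`, depth ≤ `L`, weight magnitude ≤ `B`,
and connectivity ≤ `s`. -/
def RclassSparse (d W L : ℕ) (B : ℝ) (s : ℕ) : Set ((Fin d → ℝ) → ℝ) :=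
  {f | ∃ Φ : ReLUNet d, Φ.widthLe W ∧ Φ.depth ≤ L ∧ Φ.magLe B ∧
    Φ.connectivity ≤ s ∧ Φ.realization = f}

/-- The unit cube `[0,1]^d`. -/
def unitCube (d : ℕ) : Set (Fin d → ℝ) := Set.univ.pi fun _ => Set.Icc (0 : ℝ) 1

/-- The `L^p([0,1]^d)` distance between two functions on `ℝ^d` (with `p = ⊤`
corresponding to `L^∞`). -/
def cubeDist (d : ℕ) (p : ℝ≥0∞) (f g : (Fin d → ℝ) → ℝ) : ℝ≥0∞ :=
  eLpNorm (f - g) p (volume.restrict (unitCube d))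

/-- The `L^p([0,1])` distance between two functions on `ℝ`. -/
def intervalDist (p : ℝ≥0∞) (f g : ℝ → ℝ) : ℝ≥0∞ :=
  eLpNorm (f - g) p (volume.restrict (Set.Icc (0 : ℝ) 1))

/-- The `ε`-covering number of `X` with respect to the extended distance `δ`:
the cardinality of a smallest subset `C ⊆ X` such that every point of `X` is within
distance `ε` of some point of `C` (equal to `⊤` if no finite covering exists). -/
def coveringNumber {α : Type*} (ε : ℝ≥0∞) (X : Set α) (δ : α → α → ℝ≥0∞) : ℕ∞ :=
  sInf {n : ℕ∞ | ∃ C : Finset α, ↑C ⊆ X ∧ (∀ x ∈ X, ∃ c ∈ C, δ x c ≤ ε) ∧ (C.card : ℕ∞) = n}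

/-- The `ε`-packing number of `X` with respect to the extended distance `δ`:
the cardinality of a largest subset of `X` whose points have pairwise distances `> ε`. -/
def packingNumber {α : Type*} (ε : ℝ≥0∞) (X : Set α) (δ : α → α → ℝ≥0∞) : ℕ∞ :=
  sSup {n : ℕ∞ | ∃ C : Finset α, ↑C ⊆ X ∧
    (∀ x ∈ C, ∀ y ∈ C, x ≠ y → ε < δ x y) ∧ (C.card : ℕ∞) = n}

/-- Base-2 logarithm of an extended natural number, valued in `ℝ≥0∞`. -/
def elog2 (n : ℕ∞) : ℝ≥0∞ :=
  if n = ⊤ then ⊤ else ENNReal.ofReal (Real.logb 2 (n.toNat : ℝ))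

/-- The minimax approximation error `A(G, F, δ) = sup_{g ∈ G} inf_{f ∈ F} δ(f, g)`. -/
def minimaxErr {α : Type*} (G F : Set α) (δ : α → α → ℝ≥0∞) : ℝ≥0∞ :=
  ⨆ g ∈ G, ⨅ f ∈ F, δ f g

/-- The activation applied to the output of layer `i`; the input (`i = 0`) is not activated. -/
def activation (i : ℕ) (t : ℝ) : ℝ := if i = 0 then t else max t 0

/-- Forward pass of a network whose weights are indexed by natural numbers, all layers being
padded to width `W`. -/
def flatForward (W : ℕ) (a : ℕ → ℕ → ℕ → ℝ) (b : ℕ → ℕ → ℝ) (x : ℕ → ℝ) : ℕ → ℕ → ℝ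
  | 0 => x
  | i + 1 => fun j =>
      (∑ k ∈ Finset.range W, a i j k * activation i (flatForward W a b x i k)) + b i j

/-- Extension of a finite vector by zero. -/
def extendZero {n : ℕ} (x : Fin n → ℝ) (k : ℕ) : ℝ := if h : k < n then x ⟨k, h⟩ else 0

theorem sum_range_extend {n W : ℕ} (hn : n ≤ W) (f : Fin n → ℝ) (g : ℕ → ℝ) :
    ∑ k ∈ Finset.range W, extendZero f k * g k = ∑ k : Fin n, f k * g k := by
  rw [← Finset.sum_subset (Finset.range_subset_range.2 hn), ← Fin.sum_univ_eq_sum_range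
    (fun k => extendZero f k * g k)]
  · simp [extendZero]
  · intro k _ hk
    have : ¬ k < n := by simpa using hk
    simp [extendZero, this]

theorem activation_succ (i : ℕ) (t : ℝ) : activation (i + 1) t = max t 0 := by simp [activation]

theorem abs_activation_le (i : ℕ) (t : ℝ) : |activation i t| ≤ |t| := by
  unfold activation
  split_ifs
  · exact le_rfl
  · rw [abs_of_nonneg (le_max_right _ _)]
    exact max_le (le_abs_self t) (abs_nonneg t)

theorem abs_activation_sub_le (i : ℕ) (s t : ℝ) :
    |activation i s - activation i t| ≤ |s - t| := by
  unfold activation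
  split_ifs
  · exact le_rfl
  · exact abs_max_sub_max_le_abs s t 0

theorem continuous_activation (i : ℕ) : Continuous (activation i) := by
  unfold activation
  split_ifs <;> fun_prop

namespace ReLUNet

variable {d : ℕ}

/-- The weight matrices of a network, extended by zero. -/
def flatA (Φ : ReLUNet d) (i j k : ℕ) : ℝ :=
  if h : j < Φ.width (i + 1) then extendZero (Φ.A i ⟨j, h⟩) k else 0

/-- The bias vectors of a network, extended by zero. -/
def flatB (Φ : ReLUNet d) (i j : ℕ) : ℝ := extendZero (Φ.b i) j

theorem forward_eq_flatForward (Φ : ReLUNet d) {W : ℕ} (hW : Φ.widthLe W)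
    (x : Fin (Φ.width 0) → ℝ) {i : ℕ} (hi : i ≤ Φ.depth) (j : Fin (Φ.width i)) :
    Φ.forward i x j = flatForward W Φ.flatA Φ.flatB (extendZero x) i j := by
  induction i with
  | zero => simp [forward, flatForward, extendZero]
  | succ i ih =>
    have hA : Φ.flatA i j = extendZero (Φ.A i j) := by
      funext k; simp [flatA]
    have hB : Φ.flatB i j = Φ.b i j := by simp [flatB, extendZero]
    simp only [forward, flatForward, layer, hA, hB,
      sum_range_extend (hW i (by omega))]
    congr 1
    refine Finset.sum_congr rfl fun k _ => ?_
    rw [← ih (by omega)]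
    simp [activation]

theorem realization_eq_flatForward (Φ : ReLUNet d) {W : ℕ} (hW : Φ.widthLe W) (x : Fin d → ℝ) :
    Φ.realization x = flatForward W Φ.flatA Φ.flatB (extendZero x) Φ.depth 0 := by
  have hx : extendZero (fun k => x (Fin.cast Φ.width_in k)) = extendZero x := by
    funext k; simp [extendZero, Φ.width_in]
  rw [realization, Φ.forward_eq_flatForward hW _ le_rfl, hx]
  simp

theorem abs_flatA_le (Φ : ReLUNet d) {B : ℝ} (hB : 0 ≤ B) (h : Φ.magLe B) {i : ℕ}
    (hi : i < Φ.depth) (j k : ℕ) : |Φ.flatA i j k| ≤ B := by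
  unfold flatA extendZero
  split_ifs
  · exact (h i hi).1 _ _
  · simpa using hB
  · simpa using hB

theorem abs_flatB_le (Φ : ReLUNet d) {B : ℝ} (hB : 0 ≤ B) (h : Φ.magLe B) {i : ℕ}
    (hi : i < Φ.depth) (j : ℕ) : |Φ.flatB i j| ≤ B := by
  unfold flatB extendZero
  split_ifs
  · exact (h i hi).2 _
  · simpa using hB

end ReLUNet

theorem continuous_flatForward {d : ℕ} (W : ℕ) (a : ℕ → ℕ → ℕ → ℝ) (b : ℕ → ℕ → ℝ) (i j : ℕ) :
    Continuous fun x : Fin d → ℝ => flatForward W a b (extendZero x) i j := by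
  induction i generalizing j with
  | zero =>
    simp only [flatForward, extendZero]
    split_ifs <;> fun_prop
  | succ i ih =>
    simp only [flatForward]
    exact (continuous_finsetSum _ fun k _ =>
      continuous_const.mul ((continuous_activation i).comp (ih k))).add continuous_const

theorem continuous_of_mem_RclassB {d W L : ℕ} {B : ℝ} {f : (Fin d → ℝ) → ℝ}
    (hf : f ∈ RclassB d W L B) : Continuous f := by
  obtain ⟨Φ, hW, -, -, rfl⟩ := hf
  rw [funext (Φ.realization_eq_flatForward hW)]
  exact continuous_flatForward ..

theorem abs_extendZero_le {n : ℕ} {x : Fin n → ℝ} (hx : x ∈ unitCube n) (k : ℕ) :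
    |extendZero x k| ≤ 1 := by
  unfold extendZero
  split_ifs with h
  · have := hx ⟨k, h⟩ (Set.mem_univ _)
    rw [abs_of_nonneg this.1]
    exact this.2
  · simp

section Perturbation

variable {W : ℕ} {B : ℝ} {x : ℕ → ℝ} {a a' : ℕ → ℕ → ℕ → ℝ} {b b' : ℕ → ℕ → ℝ} {D : ℕ}

theorem abs_flatForward_le (hB : 1 ≤ B) (hx : ∀ k, |x k| ≤ 1)
    (ha : ∀ i < D, ∀ j < W, ∀ k < W, |a i j k| ≤ B) (hb : ∀ i < D, ∀ j < W, |b i j| ≤ B)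
    {i : ℕ} (hi : i ≤ D) {j : ℕ} (hj : j < W) :
    |flatForward W a b x i j| ≤ (((W : ℝ) + 1) * B) ^ i := by
  induction i generalizing j with
  | zero => simpa [flatForward] using hx j
  | succ i ih =>
    set V := (((W : ℝ) + 1) * B) ^ i with hV
    have hV1 : 1 ≤ V := one_le_pow₀ (by nlinarith [(Nat.cast_nonneg W : (0 : ℝ) ≤ W)])
    have hsum : |∑ k ∈ Finset.range W, a i j k * activation i (flatForward W a b x i k)|
        ≤ W * (B * V) := by
      refine (Finset.abs_sum_le_sum_abs _ _).trans ?_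
      refine (Finset.sum_le_card_nsmul _ _ (B * V) fun k hk => ?_).trans
        (by rw [Finset.card_range, nsmul_eq_mul])
      have hk := Finset.mem_range.1 hk
      rw [abs_mul]
      exact mul_le_mul (ha i (by omega) j hj k hk)
        ((abs_activation_le _ _).trans (ih (by omega) hk)) (abs_nonneg _) (by linarith)
    calc |flatForward W a b x (i + 1) j| ≤ W * (B * V) + B :=
          (abs_add_le _ _).trans (add_le_add hsum (hb i (by omega) j hj))
      _ ≤ (((W : ℝ) + 1) * B) ^ (i + 1) := by rw [pow_succ, ← hV]; nlinarith

theorem abs_flatForward_sub_le (hB : 1 ≤ B) (hx : ∀ k, |x k| ≤ 1)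
    (ha : ∀ i < D, ∀ j < W, ∀ k < W, |a i j k| ≤ B) (hb : ∀ i < D, ∀ j < W, |b i j| ≤ B)
    (ha' : ∀ i < D, ∀ j < W, ∀ k < W, |a' i j k| ≤ B) {η : ℝ} (hη : 0 ≤ η)
    (haa : ∀ i < D, ∀ j < W, ∀ k < W, |a i j k - a' i j k| ≤ η)
    (hbb : ∀ i < D, ∀ j < W, |b i j - b' i j| ≤ η)
    {i : ℕ} (hi : i ≤ D) {j : ℕ} (hj : j < W) :
    |flatForward W a b x i j - flatForward W a' b' x i j|
      ≤ i * η * (((W : ℝ) + 1) * B) ^ i := by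
  induction i generalizing j with
  | zero => simp [flatForward]
  | succ i ih =>
    have hW0 : (0 : ℝ) ≤ W := Nat.cast_nonneg W
    set V := (((W : ℝ) + 1) * B) ^ i with hV
    have hV1 : 1 ≤ V := one_le_pow₀ (by nlinarith)
    have hsum : |∑ k ∈ Finset.range W, (a i j k * activation i (flatForward W a b x i k)
        - a' i j k * activation i (flatForward W a' b' x i k))| ≤ W * (η * V + B * (i * η * V)) := by
      refine (Finset.abs_sum_le_sum_abs _ _).trans ?_
      refine (Finset.sum_le_card_nsmul _ _ (η * V + B * (i * η * V)) fun k hk => ?_).trans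
        (by rw [Finset.card_range, nsmul_eq_mul])
      have hk := Finset.mem_range.1 hk
      have h1 : |(a i j k - a' i j k) * activation i (flatForward W a b x i k)| ≤ η * V := by
        rw [abs_mul]
        exact mul_le_mul (haa i (by omega) j hj k hk)
          ((abs_activation_le _ _).trans (abs_flatForward_le hB hx ha hb (by omega) hk))
          (abs_nonneg _) hη
      have h2 : |a' i j k * (activation i (flatForward W a b x i k)
          - activation i (flatForward W a' b' x i k))| ≤ B * (i * η * V) := by
        rw [abs_mul]
        exact mul_le_mul (ha' i (by omega) j hj k hk)
          ((abs_activation_sub_le _ _ _).trans (ih (by omega) hk)) (abs_nonneg _) (by linarith)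
      calc _ = |(a i j k - a' i j k) * activation i (flatForward W a b x i k)
            + a' i j k * (activation i (flatForward W a b x i k)
          - activation i (flatForward W a' b' x i k))| := by congr 1; ring
        _ ≤ _ := (abs_add_le _ _).trans (add_le_add h1 h2)
    calc |flatForward W a b x (i + 1) j - flatForward W a' b' x (i + 1) j|
        = |∑ k ∈ Finset.range W, (a i j k * activation i (flatForward W a b x i k)
        - a' i j k * activation i (flatForward W a' b' x i k)) + (b i j - b' i j)| := by
          rw [Finset.sum_sub_distrib]; simp only [flatForward]; congr 1; ring
      _ ≤ W * (η * V + B * (i * η * V)) + η :=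
          (abs_add_le _ _).trans (add_le_add hsum (hbb i (by omega) j hj))
      _ ≤ (W + 1) * (η * V) + (W + 1) * (B * (i * η * V)) := by
          have h1 : 0 ≤ B * (i * η * V) := by positivity
          have h2 : η ≤ η * V := le_mul_of_one_le_right hη hV1
          linarith
      _ ≤ (W + 1) * (B * (η * V)) + (W + 1) * (B * (i * η * V)) := by
          have : η * V ≤ B * (η * V) := le_mul_of_one_le_left (by positivity) hB
          gcongr
      _ = ((i + 1 : ℕ) : ℝ) * η * (((W : ℝ) + 1) * B) ^ (i + 1) := by
          rw [pow_succ, ← hV]; push_cast; ring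

end Perturbation

/-- The index of the cell of length `η` of the interval `[-B, B]` containing `t`. -/
def quantize (B η t : ℝ) : Fin (⌊2 * B / η⌋₊ + 1) := Fin.ofNat _ ⌊(t + B) / η⌋₊

theorem abs_sub_le_of_quantize_eq {B η s t : ℝ} (hη : 0 < η) (hs : |s| ≤ B) (ht : |t| ≤ B)
    (h : quantize B η s = quantize B η t) : |s - t| ≤ η := by
  have key : ∀ {u : ℝ}, |u| ≤ B → 0 ≤ (u + B) / η ∧
      (quantize B η u : ℕ) = ⌊(u + B) / η⌋₊ := fun {u} hu => by
    obtain ⟨h1, h2⟩ := abs_le.1 hu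
    refine ⟨div_nonneg (by linarith) hη.le, ?_⟩
    rw [quantize, Fin.val_ofNat, Nat.mod_eq_of_lt]
    refine Nat.lt_succ_of_le (Nat.floor_le_floor ?_)
    gcongr
    linarith
  obtain ⟨hs0, hs1⟩ := key hs
  obtain ⟨ht0, ht1⟩ := key ht
  have hf : ⌊(s + B) / η⌋₊ = ⌊(t + B) / η⌋₊ := by rw [← hs1, ← ht1, h]
  have h1 := Nat.floor_le hs0
  have h2 := Nat.lt_floor_add_one ((s + B) / η)
  have h3 := Nat.floor_le ht0
  have h4 := Nat.lt_floor_add_one ((t + B) / η)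
  rw [hf] at h1 h2
  have h5 : |(s + B) / η - (t + B) / η| ≤ 1 := abs_le.2 ⟨by linarith, by linarith⟩
  rw [← sub_div, add_sub_add_right_eq_sub, abs_div, abs_of_pos hη, div_le_one hη] at h5
  exact h5

/-- Finite codes recording the depth and the quantized weights of a network. -/
abbrev NetCode (W L K : ℕ) : Type :=
  Fin (L + 1) × (Fin L × Fin W × Fin W → Fin K) × (Fin L × Fin W → Fin K)

namespace ReLUNet

variable {d : ℕ}

/-- The code of a network at resolution `η`. -/
def code (W L : ℕ) (B η : ℝ) (Φ : ReLUNet d) : NetCode W L (⌊2 * B / η⌋₊ + 1) :=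
  (Fin.ofNat _ Φ.depth, fun ijk => quantize B η (Φ.flatA ijk.1 ijk.2.1 ijk.2.2),
    fun ij => quantize B η (Φ.flatB ij.1 ij.2))

theorem abs_realization_sub_le_of_code_eq {W L : ℕ} {B η : ℝ} (hW : 0 < W) (hB : 1 ≤ B)
    (hη : 0 < η) {Φ Ψ : ReLUNet d} (hΦW : Φ.widthLe W) (hΨW : Ψ.widthLe W) (hΦL : Φ.depth ≤ L)
    (hΨL : Ψ.depth ≤ L) (hΦB : Φ.magLe B) (hΨB : Ψ.magLe B)
    (h : Φ.code W L B η = Ψ.code W L B η) {x : Fin d → ℝ} (hx : x ∈ unitCube d) :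
    |Φ.realization x - Ψ.realization x| ≤ L * η * (((W : ℝ) + 1) * B) ^ L := by
  have hB0 : (0 : ℝ) ≤ B := by linarith
  simp only [code, Prod.mk.injEq] at h
  obtain ⟨hD, hA, hb⟩ := h
  have hD : Φ.depth = Ψ.depth := by
    have := congrArg Fin.val hD
    rwa [Fin.val_ofNat, Fin.val_ofNat, Nat.mod_eq_of_lt (by omega),
      Nat.mod_eq_of_lt (by omega)] at this
  rw [Φ.realization_eq_flatForward hΦW, Ψ.realization_eq_flatForward hΨW, ← hD]
  refine (abs_flatForward_sub_le (D := Φ.depth) hB (abs_extendZero_le hx)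
    (fun i hi j _ k _ => Φ.abs_flatA_le hB0 hΦB hi j k)
    (fun i hi j _ => Φ.abs_flatB_le hB0 hΦB hi j)
    (fun i hi j _ k _ => Ψ.abs_flatA_le hB0 hΨB (hD ▸ hi) j k) hη.le
    (fun i hi j hj k hk => ?_) (fun i hi j hj => ?_) le_rfl hW).trans ?_
  · exact abs_sub_le_of_quantize_eq hη (Φ.abs_flatA_le hB0 hΦB hi j k)
      (Ψ.abs_flatA_le hB0 hΨB (hD ▸ hi) j k)
      (congrFun hA (⟨i, by omega⟩, ⟨j, hj⟩, ⟨k, hk⟩))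
  · exact abs_sub_le_of_quantize_eq hη (Φ.abs_flatB_le hB0 hΦB hi j)
      (Ψ.abs_flatB_le hB0 hΨB (hD ▸ hi) j) (congrFun hb (⟨i, by omega⟩, ⟨j, hj⟩))
  · have h1 : (1 : ℝ) ≤ ((W : ℝ) + 1) * B := by
      nlinarith [(Nat.cast_nonneg W : (0 : ℝ) ≤ W)]
    have h2 : (Φ.depth : ℝ) ≤ L := by exact_mod_cast hΦL
    gcongr

end ReLUNet

instance (d : ℕ) : IsProbabilityMeasure (volume.restrict (unitCube d)) := by
  refine ⟨?_⟩
  rw [Measure.restrict_apply_univ, unitCube, volume_pi_pi]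
  simp

theorem measurableSet_unitCube (d : ℕ) : MeasurableSet (unitCube d) :=
  MeasurableSet.univ_pi fun _ => measurableSet_Icc

theorem cubeDist_le_of_abs_sub_le {d : ℕ} (p : ℝ≥0∞) {f g : (Fin d → ℝ) → ℝ} {ε : ℝ}
    (h : ∀ x ∈ unitCube d, |f x - g x| ≤ ε) : cubeDist d p f g ≤ ENNReal.ofReal ε := by
  refine (eLpNorm_le_of_ae_bound (C := ε) ?_).trans (by simp)
  exact (ae_restrict_iff' (measurableSet_unitCube d)).2 (.of_forall h)

theorem logb_card_netCode_le {W L : ℕ} {B ε : ℝ} (hW : 0 < W) (hL : 0 < L) (hB : 1 ≤ B)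
    (hε : 0 < ε) (hε' : ε < 1 / 8) :
    Real.logb 2 (Fintype.card (NetCode W L
        (⌊2 * B / (ε / (L * (((W : ℝ) + 1) * B) ^ L))⌋₊ + 1)))
      ≤ 12 * ((W : ℝ) ^ 2 * L) * Real.logb 2 (((W : ℝ) + 1) ^ L * B ^ L / ε) := by
  rw [← mul_pow]
  set R := (((W : ℝ) + 1) * B) ^ L with hR
  set K := ⌊2 * B / (ε / (L * R))⌋₊ + 1 with hK
  have hW1 : (1 : ℝ) ≤ W := by exact_mod_cast hW
  have hL1 : (1 : ℝ) ≤ L := by exact_mod_cast hL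
  have hbase : 2 * B ≤ ((W : ℝ) + 1) * B := by nlinarith
  have hBR : B ≤ R := by
    refine le_trans ?_ (le_self_pow₀ (by linarith) hL.ne')
    linarith
  have hLR : (L : ℝ) ≤ R := by
    have h1 : (L : ℝ) ≤ (2 : ℝ) ^ L := by exact_mod_cast Nat.lt_two_pow_self.le
    exact h1.trans (pow_le_pow_left₀ (by norm_num) (by linarith) L)
  have hR1 : 1 ≤ R := hL1.trans hLR
  have hεi : 8 ≤ 1 / ε := by rw [le_div_iff₀ hε]; linarith
  set X := R / ε with hX
  have hX8 : 8 * R ≤ X := by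
    rw [hX, div_eq_mul_one_div]; nlinarith
  have hRX : R ≤ X := by linarith
  have hX1 : 8 ≤ X := by linarith
  have hKX : (K : ℝ) ≤ X ^ 4 := by
    have h1 : (K : ℝ) ≤ 2 * B / (ε / (L * R)) + 1 := by
      rw [hK]; push_cast
      gcongr
      exact Nat.floor_le (by positivity)
    have h2 : 2 * B / (ε / (L * R)) = 2 * (B * L) * X := by
      rw [hX]; field_simp
    have h3 : B * L ≤ X * X := mul_le_mul (hBR.trans hRX) (hLR.trans hRX) (by linarith)
      (by linarith)
    have h4 : 2 * (B * L) * X ≤ 2 * (X * X) * X := by gcongr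
    have h5 : 512 ≤ X ^ 3 := by
      calc (512 : ℝ) = 8 ^ 3 := by norm_num
        _ ≤ X ^ 3 := by gcongr
    nlinarith
  have hlog : Real.logb 2 X = Real.logb 2 (X ^ 4) / 4 := by
    rw [Real.logb_pow]; push_cast; ring
  have hlX : 0 ≤ Real.logb 2 X := Real.logb_nonneg (by norm_num) (by linarith)
  have hlK : Real.logb 2 K ≤ 4 * Real.logb 2 X := by
    have : Real.logb 2 K ≤ Real.logb 2 (X ^ 4) :=
      Real.logb_le_logb_of_le (by norm_num) (by rw [hK]; positivity) hKX
    linarith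
  have hlL : Real.logb 2 ((L : ℝ) + 1) ≤ Real.logb 2 X :=
    Real.logb_le_logb_of_le (by norm_num) (by positivity) (by linarith)
  have hcard : Fintype.card (NetCode W L K) = (L + 1) * (K ^ (L * (W * W)) * K ^ (L * W)) := by
    simp [NetCode]
  have hK0 : (K : ℝ) ≠ 0 := by rw [hK]; positivity
  rw [hcard]
  push_cast
  rw [Real.logb_mul (by positivity) (by positivity), Real.logb_mul (by positivity) (by positivity),
    Real.logb_pow, Real.logb_pow]
  push_cast
  have h1 : (L : ℝ) * (W * W) * Real.logb 2 K ≤ L * (W * W) * (4 * Real.logb 2 X) := by gcongr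
  have h2 : (L : ℝ) * W * Real.logb 2 K ≤ L * W * (4 * Real.logb 2 X) := by gcongr
  have h3 : (L : ℝ) * W ≤ W ^ 2 * L := by
    have : (L : ℝ) * W * 1 ≤ L * W * W := by gcongr
    linarith
  have h4 : 1 ≤ (W : ℝ) ^ 2 * L := one_le_mul_of_one_le_of_one_le (one_le_pow₀ hW1) hL1
  have h5 : (L : ℝ) * W * (4 * Real.logb 2 X) ≤ W ^ 2 * L * (4 * Real.logb 2 X) := by gcongr
  have h6 : 1 * Real.logb 2 X ≤ W ^ 2 * L * Real.logb 2 X := by gcongr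
  have h7 : 0 ≤ (W : ℝ) ^ 2 * L * Real.logb 2 X := by positivity
  nlinarith

theorem logb_card_le_of_separated {d W L : ℕ} {B ε : ℝ} {p : ℝ≥0∞} (hW : 0 < W) (hL : 0 < L)
    (hB : 1 ≤ B) (hε : 0 < ε) (hε' : ε < 1 / 8) {γ : Type*} [Fintype γ] [Nonempty γ]
    {f : γ → (Fin d → ℝ) → ℝ} (hf : ∀ i, f i ∈ RclassB d W L B)
    (hsep : ∀ i j, i ≠ j → ENNReal.ofReal ε < cubeDist d p (f i) (f j)) :
    Real.logb 2 (Fintype.card γ)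
      ≤ 12 * ((W : ℝ) ^ 2 * L) * Real.logb 2 (((W : ℝ) + 1) ^ L * B ^ L / ε) := by
  refine le_trans ?_ (logb_card_netCode_le hW hL hB hε hε')
  refine Real.logb_le_logb_of_le (by norm_num) (by exact_mod_cast Fintype.card_pos) ?_
  have hR : 0 < (L : ℝ) * (((W : ℝ) + 1) * B) ^ L := by positivity
  set η := ε / (L * (((W : ℝ) + 1) * B) ^ L) with hη
  choose Φ hΦW hΦL hΦB hΦ using hf
  refine Nat.cast_le.2 (Fintype.card_le_of_injective (fun i => (Φ i).code W L B η) ?_)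
  intro i j hij
  by_contra hne
  refine (hsep i j hne).not_ge (cubeDist_le_of_abs_sub_le p fun x hx => ?_)
  rw [← hΦ i, ← hΦ j]
  refine (ReLUNet.abs_realization_sub_le_of_code_eq hW hB (div_pos hε hR) (hΦW i) (hΦW j)
    (hΦL i) (hΦL j) (hΦB i) (hΦB j) hij hx).trans (le_of_eq ?_)
  field_simp

theorem logb_card_le_of_minimaxErr_le {d W L : ℕ} {B ε : ℝ} {p : ℝ≥0∞} (hp : 1 ≤ p)
    (hW : 0 < W) (hL : 0 < L) (hB : 1 ≤ B) (hε : 0 < ε) (hε' : ε < 1 / 8)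
    {G : Set ((Fin d → ℝ) → ℝ)} (hG : minimaxErr G (RclassB d W L B) (cubeDist d p)
      ≤ ENNReal.ofReal ε) {γ : Type*} [Fintype γ] [Nonempty γ]
    {g : γ → (Fin d → ℝ) → ℝ} (hg : ∀ i, g i ∈ G) (hgc : ∀ i, Continuous (g i))
    (hsep : ∀ i j, i ≠ j → ENNReal.ofReal (5 * ε) < cubeDist d p (g i) (g j)) :
    Real.logb 2 (Fintype.card γ)
      ≤ 12 * ((W : ℝ) ^ 2 * L) * Real.logb 2 (((W : ℝ) + 1) ^ L * B ^ L / ε) := by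
  have hex : ∀ i, ∃ f ∈ RclassB d W L B, cubeDist d p f (g i) < ENNReal.ofReal (2 * ε) := by
    intro i
    have h1 : (⨅ f ∈ RclassB d W L B, cubeDist d p f (g i)) ≤ ENNReal.ofReal ε := by
      rw [minimaxErr, iSup₂_le_iff] at hG
      exact hG (g i) (hg i)
    have h2 := h1.trans_lt ((ENNReal.ofReal_lt_ofReal_iff (by linarith)).2
      (by linarith : ε < 2 * ε))
    simpa [iInf_lt_iff] using h2
  choose f hf hfg using hex
  refine logb_card_le_of_separated (p := p) hW hL hB hε hε' hf fun i j hij => ?_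
  by_contra! hle
  refine (hsep i j hij).not_ge ?_
  have meas : ∀ {u v : (Fin d → ℝ) → ℝ}, Continuous u → Continuous v →
      AEStronglyMeasurable (u - v) (volume.restrict (unitCube d)) :=
    fun hu hv => (hu.sub hv).aestronglyMeasurable
  have hfc := fun i => continuous_of_mem_RclassB (hf i)
  have hfg' : cubeDist d p (g i) (f i) ≤ ENNReal.ofReal (2 * ε) := by
    have := (hfg i).le
    rwa [cubeDist, eLpNorm_sub_comm] at this
  have e : g i - g j = (g i - f i) + ((f i - f j) + (f j - g j)) := by abel
  calc cubeDist d p (g i) (g j)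
      ≤ cubeDist d p (g i) (f i) + (cubeDist d p (f i) (f j) + cubeDist d p (f j) (g j)) := by
        simp only [cubeDist]
        rw [e]
        exact (eLpNorm_add_le (meas (hgc i) (hfc i))
          ((meas (hfc i) (hfc j)).add (meas (hfc j) (hgc j))) hp).trans
          (add_le_add le_rfl (eLpNorm_add_le (meas (hfc i) (hfc j)) (meas (hfc j) (hgc j)) hp))
    _ ≤ ENNReal.ofReal (2 * ε) + (ENNReal.ofReal ε + ENNReal.ofReal (2 * ε)) :=
        add_le_add hfg' (add_le_add hle (hfg j).le)
    _ = ENNReal.ofReal (5 * ε) := by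
        rw [← ENNReal.ofReal_add (by linarith) (by linarith),
          ← ENNReal.ofReal_add (by linarith) (by linarith)]
        congr 1; ring

theorem flatForward_congr {W : ℕ} {a a' : ℕ → ℕ → ℕ → ℝ} {b b' : ℕ → ℕ → ℝ} (x : ℕ → ℝ) {i : ℕ}
    (ha : ∀ m < i, a m = a' m) (hb : ∀ m < i, b m = b' m) :
    flatForward W a b x i = flatForward W a' b' x i := by
  induction i with
  | zero => rfl
  | succ i ih =>
    funext j
    simp only [flatForward]
    rw [ih (fun m hm => ha m (by omega)) (fun m hm => hb m (by omega)), ha i (by omega),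
      hb i (by omega)]

/-- The network with hidden layers of width `W` given by weights indexed by natural numbers. -/
def ReLUNet.ofFlat (d W D : ℕ) (hD : 0 < D) (a : ℕ → ℕ → ℕ → ℝ) (b : ℕ → ℕ → ℝ) : ReLUNet d where
  depth := D
  depth_pos := hD
  width i := if i = 0 then d else if i = D then 1 else W
  width_in := by simp
  width_out := by simp [hD.ne']
  A i j k := a i j k
  b i j := b i j

theorem ReLUNet.forward_ofFlat {d W D : ℕ} (hD : 0 < D) (hdW : d ≤ W) (a : ℕ → ℕ → ℕ → ℝ)
    (b : ℕ → ℕ → ℝ) (x : Fin ((ofFlat d W D hD a b).width 0) → ℝ) {i : ℕ} (hi : i ≤ D)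
    (j : Fin ((ofFlat d W D hD a b).width i)) :
    (ofFlat d W D hD a b).forward i x j = flatForward W a b (extendZero x) i j := by
  induction i with
  | zero => simp [forward, flatForward, extendZero]
  | succ i ih =>
    simp only [forward, flatForward, layer]
    congr 1
    have h1 : ∀ k : Fin ((ofFlat d W D hD a b).width i),
        (ofFlat d W D hD a b).A i j k * (if i = 0 then (ofFlat d W D hD a b).forward i x k
          else max ((ofFlat d W D hD a b).forward i x k) 0)
        = (fun k => a i j k * activation i (flatForward W a b (extendZero x) i k)) k := fun k => by
      rw [ih (by omega)]
      simp [activation, ofFlat]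
    rw [Finset.sum_congr rfl fun k _ => h1 k, Fin.sum_univ_eq_sum_range
      (fun k => a i j k * activation i (flatForward W a b (extendZero x) i k))]
    rcases Nat.eq_zero_or_pos i with rfl | hi0
    · refine Finset.sum_subset (Finset.range_subset_range.2 (by simpa [ofFlat] using hdW))
        fun k _ hk => ?_
      have hk' : ¬ k < (ofFlat d W D hD a b).width 0 := by simpa using hk
      simp [activation, flatForward, extendZero, hk']
    · have : (ofFlat d W D hD a b).width i = W := by
        simp [ofFlat, hi0.ne', show i ≠ D by omega]
      rw [this]

theorem flatForward_mem_RclassB {d W L D : ℕ} {B : ℝ} (hd : 0 < d) (hdW : d ≤ W) (hD : 0 < D)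
    (hDL : D ≤ L) {a : ℕ → ℕ → ℕ → ℝ} {b : ℕ → ℕ → ℝ} (ha : ∀ i j k, |a i j k| ≤ B)
    (hb : ∀ i j, |b i j| ≤ B) :
    (fun x : Fin d → ℝ => flatForward W a b (extendZero x) D 0) ∈ RclassB d W L B := by
  refine ⟨.ofFlat d W D hD a b, fun i _ => ?_, hDL, fun i _ => ⟨fun j k => ha i j k,
    fun j => hb i j⟩, ?_⟩
  · simp only [ReLUNet.ofFlat]
    split_ifs <;> omega
  · funext x
    refine (ReLUNet.forward_ofFlat hD hdW a b _ (le_refl D) _).trans ?_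
    have hx : extendZero (fun k => x (Fin.cast (ReLUNet.ofFlat d W D hD a b).width_in k))
        = extendZero x := by
      funext k; simp [extendZero, (ReLUNet.ofFlat d W D hD a b).width_in]
    rw [hx]
    rfl

/-- `F` is the activated output of the `k`-th layer of some network of width at most `W` and
weight magnitude at most `B`. -/
def IsHidden {d : ℕ} (W : ℕ) (B : ℝ) (k : ℕ) {ι : Type} (F : (Fin d → ℝ) → ι → ℝ) : Prop :=
  ∃ (a : ℕ → ℕ → ℕ → ℝ) (b : ℕ → ℕ → ℝ) (e : ι → ℕ), (∀ i j m, |a i j m| ≤ B) ∧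
    (∀ i j, |b i j| ≤ B) ∧ e.Injective ∧ (∀ i, e i < W) ∧
    ∀ x i, activation k (flatForward W a b (extendZero x) k (e i)) = F x i

/-- `g` is an affine combination of the components of `F` with coefficients bounded by `B`. -/
def IsAffine {X ι : Type} [Fintype ι] (B : ℝ) (F : X → ι → ℝ) (g : X → ℝ) : Prop :=
  ∃ (A : ι → ℝ) (β : ℝ), (∀ i, |A i| ≤ B) ∧ |β| ≤ B ∧ ∀ x, g x = ∑ i, A i * F x i + β

section Hidden

variable {d W k : ℕ} {B : ℝ} {ι κ : Type} [Fintype ι] {F : (Fin d → ℝ) → ι → ℝ}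

theorem isHidden_input (hdW : d ≤ W) (hB : 0 ≤ B) :
    IsHidden W B 0 fun (x : Fin d → ℝ) i => x i := by
  refine ⟨0, 0, Fin.val, by simpa, by simpa, Fin.val_injective, fun i => i.2.trans_le hdW, ?_⟩
  intro x i
  simp [activation, flatForward, extendZero]

theorem IsHidden.exists_affine (hF : IsHidden W B k F) (hB : 0 ≤ B) {g : κ → (Fin d → ℝ) → ℝ}
    (hg : ∀ j, IsAffine B F (g j)) {e' : κ → ℕ} (he' : e'.Injective) :
    ∃ (a : ℕ → ℕ → ℕ → ℝ) (b : ℕ → ℕ → ℝ), (∀ i j m, |a i j m| ≤ B) ∧ (∀ i j, |b i j| ≤ B) ∧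
      ∀ x j, flatForward W a b (extendZero x) (k + 1) (e' j) = g j x := by
  obtain ⟨a, b, e, ha, hb, he, heW, hF⟩ := hF
  choose A β hA hβ hg using hg
  refine ⟨Function.update a k (Function.extend e' (fun j => Function.extend e (A j) 0) 0),
    Function.update b k (Function.extend e' β 0), fun i j m => ?_, fun i j => ?_, fun x j => ?_⟩
  · rcases eq_or_ne i k with rfl | hi
    · rw [Function.update_self]
      by_cases hj : ∃ j', e' j' = j
      · obtain ⟨j, rfl⟩ := hj
        rw [he'.extend_apply]
        by_cases hm : ∃ m', e m' = m
        · obtain ⟨m, rfl⟩ := hm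
          rw [he.extend_apply]
          exact hA j m
        · rw [Function.extend_apply' _ _ _ hm]
          simpa
      · rw [Function.extend_apply' _ _ _ hj]
        simpa
    · rw [Function.update_of_ne hi]
      exact ha i j m
  · rcases eq_or_ne i k with rfl | hi
    · rw [Function.update_self]
      by_cases hj : ∃ j', e' j' = j
      · obtain ⟨j, rfl⟩ := hj
        rw [he'.extend_apply]
        exact hβ j
      · rw [Function.extend_apply' _ _ _ hj]
        simpa
    · rw [Function.update_of_ne hi]
      exact hb i j
  · simp only [flatForward, Function.update_self, he'.extend_apply]
    rw [flatForward_congr (a' := a) (b' := b) _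
      (fun m hm => Function.update_of_ne hm.ne _ _) (fun m hm => Function.update_of_ne hm.ne _ _),
      hg j x]
    congr 1
    rw [← Finset.sum_subset (s₁ := Finset.univ.image e)]
    · rw [Finset.sum_image fun _ _ _ _ h => he h]
      exact Finset.sum_congr rfl fun i _ => by rw [he.extend_apply, hF]
    · intro m hm
      obtain ⟨i, -, rfl⟩ := Finset.mem_image.1 hm
      exact Finset.mem_range.2 (heW i)
    · intro m _ hm
      rw [Function.extend_apply' _ _ _ (by simpa using hm)]
      simp

theorem IsHidden.layer [Fintype κ] (hF : IsHidden W B k F) (hB : 0 ≤ B)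
    (hκ : Fintype.card κ ≤ W) {G : (Fin d → ℝ) → κ → ℝ}
    (hG : ∀ j, ∃ g, IsAffine B F g ∧ ∀ x, G x j = max (g x) 0) : IsHidden W B (k + 1) G := by
  choose g hg hGg using hG
  have he' : Function.Injective fun j : κ => (Fintype.equivFin κ j : ℕ) :=
    Fin.val_injective.comp (Fintype.equivFin κ).injective
  obtain ⟨a, b, ha, hb, h⟩ := hF.exists_affine hB hg he'
  refine ⟨a, b, _, ha, hb, he', fun j => (Fin.is_lt _).trans_le hκ, fun x j => ?_⟩
  rw [h, activation_succ, hGg]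

theorem IsHidden.mem_RclassB {L : ℕ} (hF : IsHidden W B k F) (hB : 0 ≤ B) (hd : 0 < d)
    (hdW : d ≤ W) (hL : k + 1 ≤ L) {g : (Fin d → ℝ) → ℝ} (hg : IsAffine B F g) :
    g ∈ RclassB d W L B := by
  obtain ⟨a, b, ha, hb, h⟩ := hF.exists_affine (κ := Unit) (g := fun _ => g) hB (fun _ => hg)
    (e' := fun _ => 0) (Function.injective_of_subsingleton _)
  have := flatForward_mem_RclassB hd hdW k.succ_pos hL ha hb
  simpa only [h _ ()] using this

end Hidden

/-- The coefficients expressing a tent function through its three hinges. -/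
def tentCoeff : Fin 3 → ℝ := ![1 / 2, -1, 1 / 2]

theorem abs_tentCoeff_le (c : Fin 3) : |tentCoeff c| ≤ 1 := by
  fin_cases c <;> norm_num [tentCoeff]

/-- The tent function supported on `[a, a + 2h]`, of height `h / 2`. -/
def tent (a h t : ℝ) : ℝ := ∑ c : Fin 3, tentCoeff c * max (t - (a + (c : ℕ) * h)) 0

theorem tent_eq (a h t : ℝ) :
    tent a h t = max (t - a) 0 / 2 - max (t - (a + h)) 0 + max (t - (a + 2 * h)) 0 / 2 := by
  simp [tent, tentCoeff, Fin.sum_univ_three]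
  ring

theorem tent_of_le {a h t : ℝ} (hh : 0 ≤ h) (ht : t ≤ a) : tent a h t = 0 := by
  rw [tent_eq, max_eq_right (by linarith), max_eq_right (by linarith),
    max_eq_right (by linarith)]
  ring

theorem tent_of_ge {a h t : ℝ} (hh : 0 ≤ h) (ht : a + 2 * h ≤ t) : tent a h t = 0 := by
  rw [tent_eq, max_eq_left (by linarith), max_eq_left (by linarith), max_eq_left (by linarith)]
  ring

theorem tent_add {a h s : ℝ} (hs : 0 ≤ s) (hsh : s ≤ h) : tent a h (a + s) = s / 2 := by
  rw [tent_eq, max_eq_left (by linarith), max_eq_right (by linarith),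
    max_eq_right (by linarith)]
  ring

/-- Among the consecutive tents of a row, at most one is nonzero at any given point. -/
theorem tent_row {a h s : ℝ} (hs : 0 ≤ s) (hsh : s ≤ h) (i j : ℕ) :
    tent (a + 2 * i * h) h (a + 2 * j * h + s) = if i = j then s / 2 else 0 := by
  have hh : 0 ≤ h := hs.trans hsh
  rcases lt_trichotomy i j with hij | rfl | hij
  · rw [if_neg hij.ne, tent_of_ge hh]
    have : (i : ℝ) + 1 ≤ j := by exact_mod_cast hij
    nlinarith
  · rw [if_pos rfl, tent_add hs hsh]
  · rw [if_neg hij.ne', tent_of_le hh]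
    have : (j : ℝ) + 1 ≤ i := by exact_mod_cast hij
    nlinarith

section Construction

variable {d W N k : ℕ} {B : ℝ}

/-- The neurons carried through the network: inhibitors of the blocks, the local coordinate,
and the accumulated output. -/
abbrev CarryIndex (N : ℕ) : Type := Fin N ⊕ Unit ⊕ Unit

/-- The values of the carried neurons. -/
def carry {X : Type} (u : X → Fin N → ℝ) (z S : X → ℝ) (x : X) : CarryIndex N → ℝ :=
  Sum.elim (u x) (Sum.elim (fun _ => z x) fun _ => S x)

theorem IsAffine.proj {X ι : Type} [Fintype ι] [DecidableEq ι] (hB : 1 ≤ B) (F : X → ι → ℝ)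
    (i : ι) : IsAffine B F fun x => F x i := by
  refine ⟨fun j => if j = i then 1 else 0, 0, fun j => ?_, by simp; linarith, fun x => by simp⟩
  dsimp only
  split_ifs <;> simp <;> linarith

/-- The width-`N` update `∑ p, ρ (∑ q, θ p q * tent q - u p)` of the accumulated output. -/
def blockUpdate {X : Type} (w : ℝ) (β : Fin N → ℝ) (θ : Fin N → Fin N → ℝ) (u : X → Fin N → ℝ)
    (z : X → ℝ) (x : X) : ℝ :=
  ∑ p, max ((∑ q, θ p q * tent (β q) w (z x)) - u x p) 0

theorem blockUpdate_nonneg {X : Type} (w : ℝ) (β : Fin N → ℝ) (θ : Fin N → Fin N → ℝ)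
    (u : X → Fin N → ℝ) (z : X → ℝ) (x : X) : 0 ≤ blockUpdate w β θ u z x :=
  Finset.sum_nonneg fun _ _ => le_max_right _ _

theorem isHidden_carry_step {u : (Fin d → ℝ) → Fin N → ℝ} {z S : (Fin d → ℝ) → ℝ} (hB : 1 ≤ B)
    (hNW : 4 * N + 2 ≤ W) (hu : ∀ x p, 0 ≤ u x p) (hz : ∀ x, 0 ≤ z x) (hS : ∀ x, 0 ≤ S x)
    (h : IsHidden W B k (carry u z S)) {w : ℝ} {β : Fin N → ℝ} {θ : Fin N → Fin N → ℝ}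
    (hβ : ∀ q (c : Fin 3), |β q + (c : ℕ) * w| ≤ 1) (hθ : ∀ p q, |θ p q| ≤ 1) :
    IsHidden W B (k + 3) (carry u z fun x => S x + blockUpdate w β θ u z x) := by
  have hB0 : 0 ≤ B := by linarith
  have hcarry : ∀ x i, 0 ≤ carry u z S x i := by
    rintro x (p | _ | _)
    · exact hu x p
    · exact hz x
    · exact hS x
  have h1 : IsHidden W B (k + 1) fun x => Sum.elim (carry u z S x)
      fun qc : Fin N × Fin 3 => max (z x - (β qc.1 + (qc.2 : ℕ) * w)) 0 := by
    refine h.layer hB0 (by simp; omega) ?_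
    rintro (i | ⟨q, c⟩)
    · exact ⟨_, .proj hB _ i, fun x => by simp [hcarry x i]⟩
    · refine ⟨fun x => z x - (β q + (c : ℕ) * w), ⟨Sum.elim 0 (Sum.elim 1 0),
        -(β q + (c : ℕ) * w), ?_, ?_, fun x => ?_⟩, fun x => rfl⟩
      · rintro (p | _ | _) <;> simp <;> linarith
      · rw [abs_neg]; exact (hβ q c).trans hB
      · simp [carry]; ring
  have h2 : IsHidden W B (k + 2) fun x => Sum.elim (carry u z S x)
      fun p : Fin N => max ((∑ q, θ p q * tent (β q) w (z x)) - u x p) 0 := by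
    refine h1.layer hB0 (by simp; omega) ?_
    rintro (i | p)
    · exact ⟨_, .proj hB _ (Sum.inl i), fun x => by simp [hcarry x i]⟩
    · refine ⟨fun x => (∑ q, θ p q * tent (β q) w (z x)) - u x p,
        ⟨Sum.elim (Sum.elim (fun p' => if p' = p then -1 else 0) 0)
          fun qc => θ p qc.1 * tentCoeff qc.2, 0, ?_, by simpa, fun x => ?_⟩, fun x => rfl⟩
      · rintro ((p' | _) | ⟨q, c⟩)
        · simp only [Sum.elim_inl]
          split_ifs <;> simp <;> linarith
        · simpa
        · simp only [Sum.elim_inr, abs_mul]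
          exact (mul_le_one₀ (hθ p q) (abs_nonneg _) (abs_tentCoeff_le c)).trans hB
      · simp [carry, Fintype.sum_prod_type, tent, Finset.mul_sum, mul_assoc]
        ring
  refine h2.layer hB0 (by simp; omega) ?_
  rintro (p | _ | _)
  · exact ⟨_, .proj hB _ (Sum.inl (Sum.inl p)), fun x => by simp [carry, hu x p]⟩
  · exact ⟨_, .proj hB _ (Sum.inl (Sum.inr (Sum.inl ()))), fun x => by simp [carry, hz x]⟩
  · refine ⟨fun x => S x + blockUpdate w β θ u z x,
      ⟨Sum.elim (Sum.elim 0 (Sum.elim 0 1)) 1, 0, ?_, by simpa, fun x => ?_⟩, fun x => ?_⟩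
    · rintro ((_ | _ | _) | _) <;> simp <;> linarith
    · simp [carry, blockUpdate]
    · simp [carry, add_nonneg (hS x) (blockUpdate_nonneg w β θ u z x)]

theorem isHidden_carry_sum {u : (Fin d → ℝ) → Fin N → ℝ} {z : (Fin d → ℝ) → ℝ} (hB : 1 ≤ B)
    (hNW : 4 * N + 2 ≤ W) (hu : ∀ x p, 0 ≤ u x p) (hz : ∀ x, 0 ≤ z x)
    (h : IsHidden W B k (carry u z 0)) {w : ℝ} {β : ℕ → Fin N → ℝ}
    {θ : ℕ → Fin N → Fin N → ℝ} {n : ℕ}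
    (hβ : ∀ l < n, ∀ q (c : Fin 3), |β l q + (c : ℕ) * w| ≤ 1) (hθ : ∀ l p q, |θ l p q| ≤ 1) :
    IsHidden W B (k + 3 * n)
      (carry u z fun x => ∑ l ∈ Finset.range n, blockUpdate w (β l) (θ l) u z x) := by
  induction n with
  | zero =>
    simp only [Finset.range_zero, Finset.sum_empty]
    exact h
  | succ n ih =>
    simp only [Finset.sum_range_succ]
    exact isHidden_carry_step hB hNW hu hz
      (fun x => Finset.sum_nonneg fun l _ => blockUpdate_nonneg ..)
      (ih fun l hl => hβ l (by omega)) (hβ n (by omega)) (hθ n)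

/-- The local coordinate of `t` within the row of `N` tents of half-width `h`. -/
def localCoord (N : ℕ) (h t : ℝ) : ℝ := max (∑ p : Fin N, tent (2 * (p : ℕ) * h) h t) 0

/-- The inhibitor of the `p`-th block, which vanishes where the `p`-th tent exceeds `w`. -/
def inhibitor (N : ℕ) (h w t : ℝ) (p : Fin N) : ℝ := max (w - tent (2 * (p : ℕ) * h) h t) 0

theorem isHidden_carry_init (hd : 0 < d) (hdW : d ≤ W) (hB : 1 ≤ B) (hNW : 4 * N + 2 ≤ W)
    {h w : ℝ} (hh : 0 ≤ h) (hNh : 2 * N * h ≤ 1) (hw : 0 ≤ w) (hw1 : w ≤ 1) :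
    IsHidden W B 2 (carry (fun x : Fin d → ℝ => inhibitor N h w (x ⟨0, hd⟩))
      (fun x => localCoord N h (x ⟨0, hd⟩)) 0) := by
  have hB0 : 0 ≤ B := by linarith
  have h1 : IsHidden W B 1 fun (x : Fin d → ℝ) (pc : Fin N × Fin 3) =>
      max (x ⟨0, hd⟩ - (2 * (pc.1 : ℕ) * h + (pc.2 : ℕ) * h)) 0 := by
    refine (isHidden_input hdW hB0).layer hB0 (by simp; omega) ?_
    rintro ⟨p, c⟩
    refine ⟨fun x => x ⟨0, hd⟩ - (2 * (p : ℕ) * h + (c : ℕ) * h),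
      ⟨fun i => if i = ⟨0, hd⟩ then 1 else 0, -(2 * (p : ℕ) * h + (c : ℕ) * h), fun i => ?_, ?_,
        fun x => by simp; ring⟩, fun x => rfl⟩
    · dsimp only
      split_ifs <;> simp <;> linarith
    · rw [abs_neg, abs_of_nonneg (by positivity)]
      have hc : ((c : ℕ) : ℝ) ≤ 2 := by exact_mod_cast Nat.le_of_lt_succ c.2
      have hp : ((p : ℕ) : ℝ) + 1 ≤ N := by exact_mod_cast p.2
      nlinarith
  refine h1.layer hB0 (by simp; omega) ?_
  rintro (p | _ | _)
  · refine ⟨fun x => w - tent (2 * (p : ℕ) * h) h (x ⟨0, hd⟩),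
      ⟨fun pc => if pc.1 = p then -tentCoeff pc.2 else 0, w, fun pc => ?_, ?_, fun x => ?_⟩,
      fun x => rfl⟩
    · dsimp only
      split_ifs
      · rw [abs_neg]; exact (abs_tentCoeff_le _).trans hB
      · simpa
    · rw [abs_of_nonneg hw]; linarith
    · simp [Fintype.sum_prod_type_right, tent, ite_mul]
      ring
  · refine ⟨fun x => ∑ p : Fin N, tent (2 * (p : ℕ) * h) h (x ⟨0, hd⟩),
      ⟨fun pc => tentCoeff pc.2, 0, fun pc => (abs_tentCoeff_le _).trans hB, by simpa,
        fun x => ?_⟩, fun x => rfl⟩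
    simp [Fintype.sum_prod_type, tent]
  · exact ⟨0, ⟨0, 0, by simp [hB0], by simpa, by simp⟩, by simp [carry]⟩

theorem isHidden_amplify {S : (Fin d → ℝ) → ℝ} (hB : 1 ≤ B) (hS : ∀ x, 0 ≤ S x)
    {ι : Type} [Fintype ι] [DecidableEq ι] {F : (Fin d → ℝ) → ι → ℝ} (hF : IsHidden W B k F)
    (i : ι) (hi : ∀ x, F x i = S x) (n : ℕ) :
    IsHidden W B (k + 1 + n) fun x (_ : Fin W) => ((W : ℝ) * B) ^ n * S x := by
  have hB0 : 0 ≤ B := by linarith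
  induction n with
  | zero =>
    exact hF.layer hB0 (by simp) fun _ => ⟨_, .proj hB _ i, fun x => by simp [hi, hS x]⟩
  | succ n ih =>
    refine ih.layer hB0 (by simp) fun _ => ⟨fun x => ((W : ℝ) * B) ^ (n + 1) * S x,
      ⟨fun _ => B, 0, fun _ => (abs_of_nonneg hB0).le, by simpa, fun x => ?_⟩, fun x => ?_⟩
    · simp; ring
    · rw [max_eq_left]
      have := hS x
      positivity

end Construction

section Evaluation

variable {N n : ℕ} {h w : ℝ}

/-- Left endpoint of the `q`-th tent of the `l`-th block. -/
def tentStart (N : ℕ) (w : ℝ) (l : ℕ) (q : Fin N) : ℝ := w + 2 * ((l * N + q : ℕ) : ℝ) * w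

/-- The output accumulated by `n` blocks with parameters `θ`, as a function of one variable. -/
def cellFunction (N n : ℕ) (h w : ℝ) (θ : ℕ → Fin N → Fin N → ℝ) (t : ℝ) : ℝ :=
  ∑ l ∈ Finset.range n, blockUpdate w (tentStart N w l) (θ l) (inhibitor N h w)
    (localCoord N h) t

theorem cellFunction_nonneg (θ : ℕ → Fin N → Fin N → ℝ) (t : ℝ) :
    0 ≤ cellFunction N n h w θ t :=
  Finset.sum_nonneg fun _ _ => blockUpdate_nonneg ..

theorem tentStart_le (hw : 0 ≤ w) {l : ℕ} (hl : l < n) (q : Fin N) :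
    tentStart N w l q + w ≤ 2 * (n * N) * w := by
  have h1 : l * N + q + 1 ≤ n * N := by nlinarith [q.2, Nat.mul_le_mul_right N hl]
  have h2 : ((l * N + q : ℕ) : ℝ) + 1 ≤ n * N := by exact_mod_cast h1
  unfold tentStart
  nlinarith

theorem le_tentStart (hw : 0 ≤ w) (l : ℕ) (q : Fin N) : w ≤ tentStart N w l q := by
  unfold tentStart
  have : 0 ≤ 2 * ((l * N + q : ℕ) : ℝ) * w := by positivity
  linarith

theorem tent_tentStart {s : ℝ} (hs : 0 ≤ s) (hsw : s ≤ w) (l l₀ : ℕ) (q q₀ : Fin N) :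
    tent (tentStart N w l q) w (tentStart N w l₀ q₀ + s)
      = if l = l₀ ∧ q = q₀ then s / 2 else 0 := by
  rw [tentStart, tentStart, tent_row hs hsw]
  congr 1
  refine propext ⟨fun he => ?_, fun ⟨h1, h2⟩ => by rw [h1, h2]⟩
  have hq : (q : ℕ) = q₀ := by
    have := congrArg (· % N) he
    simpa [Nat.mul_add_mod', Nat.mod_eq_of_lt] using this
  have hN : 0 < N := q.pos
  rw [hq, Nat.add_right_cancel_iff] at he
  exact ⟨Nat.eq_of_mul_eq_mul_right hN he, Fin.ext hq⟩

theorem cellFunction_apply (hw : 0 ≤ w) (hwh : 4 * (n * N) * w ≤ h)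
    {θ : ℕ → Fin N → Fin N → ℝ} (hθ : ∀ l p q, θ l p q ∈ Set.Icc (0 : ℝ) 1) {l₀ : ℕ}
    (hl₀ : l₀ < n) (p₀ q₀ : Fin N) {s : ℝ} (hs : 0 ≤ s) (hsw : s ≤ w) :
    cellFunction N n h w θ (2 * (p₀ : ℕ) * h + 2 * (tentStart N w l₀ q₀ + s))
      = θ l₀ p₀ q₀ * (s / 2) := by
  have hw1 := le_tentStart hw l₀ q₀
  have hw2 := tentStart_le hw hl₀ q₀
  set r := tentStart N w l₀ q₀ + s with hr
  have htent : ∀ p : Fin N, tent (2 * (p : ℕ) * h) h (2 * (p₀ : ℕ) * h + 2 * r)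
      = if p = p₀ then r else 0 := fun p => by
    have := tent_row (a := 0) (h := h) (s := 2 * r) (by linarith) (by linarith) p p₀
    rw [zero_add, zero_add] at this
    simp [this, Fin.val_inj]
  have hz : localCoord N h (2 * (p₀ : ℕ) * h + 2 * r) = r := by
    rw [localCoord, Finset.sum_congr rfl fun p _ => htent p]
    simp
    linarith
  have hu : ∀ p, inhibitor N h w (2 * (p₀ : ℕ) * h + 2 * r) p = if p = p₀ then 0 else w :=
    fun p => by
    rw [inhibitor, htent]
    split_ifs
    · exact max_eq_right (by linarith)
    · rw [sub_zero, max_eq_left hw]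
  have hterm : ∀ l p, max ((∑ q, θ l p q * tent (tentStart N w l q) w r)
      - inhibitor N h w (2 * (p₀ : ℕ) * h + 2 * r) p) 0
      = if p = p₀ then (if l = l₀ then θ l₀ p₀ q₀ * (s / 2) else 0) else 0 := fun l p => by
    rw [hu, Finset.sum_congr rfl fun q _ => by rw [hr, tent_tentStart hs hsw l l₀ q q₀]]
    rcases eq_or_ne l l₀ with rfl | hl
    · have h0 := mul_nonneg (hθ l p q₀).1 hs
      have h1 := mul_le_of_le_one_left hs (hθ l p q₀).2
      rcases eq_or_ne p p₀ with rfl | hp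
      · simp
        linarith
      · simp [hp]
        linarith
    · rcases eq_or_ne p p₀ with rfl | hp <;> simp [*]
  rw [cellFunction]
  simp only [blockUpdate, hz, hterm]
  simp [hl₀]

end Evaluation

theorem ofReal_le_cubeDist {d : ℕ} {p : ℝ≥0∞} (hp : 1 ≤ p) (i : Fin d)
    {f g : (Fin d → ℝ) → ℝ} (hf : Continuous f) (hg : Continuous g) {α w c : ℝ} (hα : 0 ≤ α)
    (hαw : α + w ≤ 1) (hc : 0 ≤ c)
    (h : ∀ x : Fin d → ℝ, x i ∈ Set.Icc α (α + w) → c ≤ |f x - g x|) :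
    ENNReal.ofReal (c * w) ≤ cubeDist d p f g := by
  have hm := (hf.sub hg).aestronglyMeasurable (μ := volume.restrict (unitCube d))
  refine le_trans ?_ (eLpNorm_le_eLpNorm_of_exponent_le hp hm)
  rw [eLpNorm_one_eq_lintegral_enorm, ENNReal.ofReal_mul hc]
  set s : Set (Fin d → ℝ) :=
    Set.univ.pi fun j => if j = i then Set.Icc α (α + w) else Set.Icc 0 1 with hs
  have hsm : MeasurableSet s := MeasurableSet.univ_pi fun j => by
    split_ifs <;> exact measurableSet_Icc
  have hsub : s ⊆ unitCube d := fun x hx j _ => by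
    have := hx j (Set.mem_univ j)
    dsimp only at this
    split_ifs at this
    · exact ⟨hα.trans this.1, this.2.trans hαw⟩
    · exact this
  have hvol : volume s = ENNReal.ofReal w := by
    rw [hs, volume_pi_pi, Finset.prod_eq_single i]
    · simp
    · intro j _ hj
      simp [hj]
    · simp
  calc ENNReal.ofReal c * ENNReal.ofReal w = ∫⁻ _ in s, ENNReal.ofReal c := by
        rw [setLIntegral_const, hvol]
    _ ≤ ∫⁻ x in s, ‖(f - g) x‖ₑ := by
        refine setLIntegral_mono' hsm fun x hx => ?_
        have hxi : x i ∈ Set.Icc α (α + w) := by simpa using hx i (Set.mem_univ i)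
        rw [Pi.sub_apply, Real.enorm_eq_ofReal_abs]
        exact ENNReal.ofReal_le_ofReal (h x hxi)
    _ ≤ ∫⁻ x in unitCube d, ‖(f - g) x‖ₑ := lintegral_mono_set hsub

theorem amplified_cellFunction_mem_RclassB {d W L N n m : ℕ} {B h w : ℝ} (hd : 0 < d)
    (hdW : d ≤ W) (hB : 1 ≤ B) (hNW : 4 * N + 2 ≤ W) (hL : 3 * n + m + 4 ≤ L) (hh : 0 ≤ h)
    (hNh : 2 * N * h ≤ 1) (hw : 0 ≤ w) (hw1 : w ≤ 1) (hnw : 2 * (n * N + 1) * w ≤ 1)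
    {θ : ℕ → Fin N → Fin N → ℝ} (hθ : ∀ l p q, θ l p q ∈ Set.Icc (0 : ℝ) 1) :
    (fun x : Fin d → ℝ => ((W : ℝ) * B) ^ m * cellFunction N n h w θ (x ⟨0, hd⟩))
      ∈ RclassB d W L B := by
  have h1 := isHidden_carry_sum (θ := θ) (n := n) (β := tentStart N w) (w := w) hB hNW
    (fun x p => le_max_right _ _) (fun x => le_max_right _ _)
    (isHidden_carry_init hd hdW hB hNW hh hNh hw hw1) (fun l hl q c => ?_)
    (fun l p q => by rw [abs_of_nonneg (hθ l p q).1]; exact (hθ l p q).2)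
  · have h2 := isHidden_amplify hB (S := fun x => cellFunction N n h w θ (x ⟨0, hd⟩))
      (fun x => cellFunction_nonneg θ _) h1 (Sum.inr (Sum.inr ())) (fun x => rfl) m
    exact h2.mem_RclassB (by linarith) hd hdW (by omega)
      (.proj hB _ (⟨0, by omega⟩ : Fin W))
  · have hq := tentStart_le hw hl q
    have hc : ((c : ℕ) : ℝ) ≤ 2 := by exact_mod_cast Nat.le_of_lt_succ c.2
    have hq' := le_tentStart hw l q
    rw [abs_of_nonneg (by have := mul_nonneg (Nat.cast_nonneg (c : ℕ) : (0 : ℝ) ≤ _) hw; linarith)]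
    nlinarith

/-- The parameters on the grid `{0, 1/Q, …, 1}` given by a family of integers. -/
def gridParam {N n Q : ℕ} (φ : Fin n × Fin N × Fin N → Fin (Q + 1)) (l : ℕ) (p q : Fin N) : ℝ :=
  if hl : l < n then ((φ (⟨l, hl⟩, p, q) : ℕ) : ℝ) / Q else 0

theorem gridParam_mem_Icc {N n Q : ℕ} (φ : Fin n × Fin N × Fin N → Fin (Q + 1)) (l : ℕ)
    (p q : Fin N) : gridParam φ l p q ∈ Set.Icc (0 : ℝ) 1 := by
  unfold gridParam
  split_ifs with hl
  · refine ⟨by positivity, div_le_one_of_le₀ ?_ (Nat.cast_nonneg _)⟩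
    exact_mod_cast Nat.le_of_lt_succ (φ (⟨l, hl⟩, p, q)).2
  · simp

theorem one_div_le_abs_gridParam_sub {N n Q : ℕ} {φ ψ : Fin n × Fin N × Fin N → Fin (Q + 1)}
    {l : Fin n} {p q : Fin N} (h : φ (l, p, q) ≠ ψ (l, p, q)) :
    1 / (Q : ℝ) ≤ |gridParam φ l p q - gridParam ψ l p q| := by
  simp only [gridParam, l.2, dite_true, ← sub_div, abs_div, Nat.abs_cast]
  gcongr
  have h1 : ((φ (l, p, q) : ℕ) : ℤ) - (ψ (l, p, q) : ℕ) ≠ 0 :=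
    sub_ne_zero.2 fun h' => h (Fin.ext (by exact_mod_cast h'))
  exact_mod_cast Int.one_le_abs h1

theorem ofReal_lt_cubeDist_amplified {d N n Q : ℕ} {p : ℝ≥0∞} (hp : 1 ≤ p) (i : Fin d)
    {h w A δ : ℝ} (hw : 0 < w) (hwh : 4 * (n * N) * w ≤ h) (hNh : 2 * N * h ≤ 1)
    (hA : 0 ≤ A) (hδ : 0 ≤ δ) (hQ : 4 * Q * δ < A * w ^ 2)
    {φ ψ : Fin n × Fin N × Fin N → Fin (Q + 1)} (hφψ : φ ≠ ψ)
    (hφ : Continuous fun x : Fin d → ℝ => A * cellFunction N n h w (gridParam φ) (x i))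
    (hψ : Continuous fun x : Fin d → ℝ => A * cellFunction N n h w (gridParam ψ) (x i)) :
    ENNReal.ofReal δ < cubeDist d p (fun x => A * cellFunction N n h w (gridParam φ) (x i))
      (fun x => A * cellFunction N n h w (gridParam ψ) (x i)) := by
  obtain ⟨⟨l, r, q⟩, hne⟩ := Function.ne_iff.1 hφψ
  have hQ0 : 0 < Q := by
    rcases Nat.eq_zero_or_pos Q with rfl | hQ0
    · exact absurd (Fin.ext (by omega)) hne
    · exact hQ0
  have hQ1 : (0 : ℝ) < Q := by exact_mod_cast hQ0
  have hb1 := le_tentStart hw.le l q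
  have hb2 := tentStart_le hw.le l.2 q
  set b := tentStart N w l q with hb
  have hh : 0 ≤ h := le_trans (by positivity) hwh
  have hr : ((r : ℕ) : ℝ) + 1 ≤ N := by exact_mod_cast r.2
  have hrh : 0 ≤ 2 * ((r : ℕ) : ℝ) * h := by positivity
  have hrN : 2 * (((r : ℕ) : ℝ) + 1) * h ≤ 1 := le_trans (by gcongr) hNh
  refine lt_of_lt_of_le ?_ (ofReal_le_cubeDist (w := w) (c := A * (1 / Q) * (w / 4))
    (α := 2 * (r : ℕ) * h + 2 * b + w) hp i hφ hψ (by linarith) (by linarith)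
    (by positivity) fun x hx => ?_)
  · have hlt : δ < A * (1 / Q) * (w / 4) * w := by
      have e : A * (1 / Q) * (w / 4) * w = A * w ^ 2 / (4 * Q) := by field_simp
      rw [e, lt_div_iff₀ (by positivity)]
      linarith
    exact (ENNReal.ofReal_lt_ofReal_iff (hδ.trans_lt hlt)).2 hlt
  · obtain ⟨hx1, hx2⟩ := hx
    set s := (x i - 2 * (r : ℕ) * h - 2 * b) / 2 with hs
    have hs1 : w / 2 ≤ s := by rw [hs]; linarith
    have hs2 : s ≤ w := by rw [hs]; linarith
    have hxs : x i = 2 * (r : ℕ) * h + 2 * (tentStart N w l q + s) := by rw [hs, hb]; ring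
    rw [hxs, cellFunction_apply hw.le hwh (gridParam_mem_Icc φ) l.2 r q (by linarith) hs2,
      cellFunction_apply hw.le hwh (gridParam_mem_Icc ψ) l.2 r q (by linarith) hs2,
      ← mul_sub, ← sub_mul, abs_mul, abs_mul, abs_of_nonneg hA,
      abs_of_nonneg (show 0 ≤ s / 2 by linarith), ← mul_assoc]
    have := one_div_le_abs_gridParam_sub hne
    exact mul_le_mul (mul_le_mul_of_nonneg_left this hA) (by linarith) (by positivity)
      (by positivity)

theorem pow_mul_sq_le {W L : ℕ} (hW : 60 ≤ W) (hL : 60 ≤ L) :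
    (W : ℝ) ^ 4 * (L : ℝ) ^ 2 ≤ (W : ℝ) ^ (L / 4) := by
  obtain ⟨k, hk⟩ : ∃ k, L / 4 = 4 + k := ⟨L / 4 - 4, by omega⟩
  have hLk : L ≤ 19 * (k + 1) := by omega
  have hk2 : k + 1 ≤ 2 ^ k := Nat.lt_two_pow_self
  have h15 : 361 ≤ 15 ^ k := le_trans (by norm_num) (Nat.pow_le_pow_right (by norm_num)
    (show 3 ≤ k by omega))
  have hsq : L ^ 2 ≤ W ^ k := calc
    L ^ 2 ≤ (19 * 2 ^ k) ^ 2 := Nat.pow_le_pow_left (hLk.trans (by omega)) 2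
    _ = 361 * 4 ^ k := by rw [mul_pow, ← pow_mul, mul_comm k, pow_mul]; norm_num
    _ ≤ 15 ^ k * 4 ^ k := Nat.mul_le_mul_right _ h15
    _ = 60 ^ k := by rw [← mul_pow]; norm_num
    _ ≤ W ^ k := Nat.pow_le_pow_left hW k
  rw [hk, pow_add]
  gcongr
  exact_mod_cast hsq

theorem logb_le_mul_logb_of_grid {W L N n μ Q : ℕ} {B ε : ℝ} (hW0 : (60 : ℝ) ≤ W)
    (hB : 1 ≤ B) (hε : 0 < ε) (hε' : ε < 1 / 8) (hWN : (W : ℝ) ≤ 10 * N)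
    (hLn : (L : ℝ) ≤ 20 * n) (hLμ : (L : ℝ) ≤ 8 * μ)
    (hQge : ((W : ℝ) * B) ^ μ / (4 * ε) ≤ (Q : ℝ) + 1) :
    1 / 32000 * ((W : ℝ) ^ 2 * L) * Real.logb 2 (((W : ℝ) + 1) ^ L * B ^ L / (4 * ε))
      ≤ n * (N * N) * Real.logb 2 ((Q : ℝ) + 1) := by
  set ℓ := Real.logb 2 ((W : ℝ) * B) with hℓ
  set κ := -Real.logb 2 (4 * ε) with hκ
  have hWB : 1 ≤ (W : ℝ) * B := one_le_mul_of_one_le_of_one_le (by linarith) hB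
  have hℓ0 : 0 ≤ ℓ := Real.logb_nonneg (by norm_num) hWB
  have hκ0 : 0 ≤ κ := by
    have := Real.logb_nonpos (b := 2) (by norm_num) (by positivity : 0 ≤ 4 * ε) (by linarith)
    linarith
  have hlower : μ * ℓ + κ ≤ Real.logb 2 ((Q : ℝ) + 1) := by
    refine le_trans (le_of_eq ?_) (Real.logb_le_logb_of_le (by norm_num) (by positivity) hQge)
    rw [Real.logb_div (by positivity) (by positivity), Real.logb_pow]
    ring
  have hupper : Real.logb 2 (((W : ℝ) + 1) ^ L * B ^ L / (4 * ε)) ≤ 2 * L * ℓ + κ := by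
    rw [← mul_pow, Real.logb_div (by positivity) (by positivity), Real.logb_pow]
    have h1 : Real.logb 2 (((W : ℝ) + 1) * B) ≤ Real.logb 2 (((W : ℝ) * B) ^ 2) := by
      refine Real.logb_le_logb_of_le (by norm_num) (by positivity) ?_
      have h2 : (W : ℝ) + 1 ≤ W * (W * B) := by nlinarith
      nlinarith
    rw [Real.logb_pow] at h1
    push_cast at h1
    have h2 : (L : ℝ) * Real.logb 2 (((W : ℝ) + 1) * B) ≤ L * (2 * ℓ) := by gcongr
    linarith
  have hM : (W : ℝ) ^ 2 * L ≤ 2000 * (n * (N * N)) := by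
    calc (W : ℝ) ^ 2 * (L : ℝ) ≤ (10 * (N : ℝ)) ^ 2 * (20 * (n : ℝ)) := by gcongr
      _ = 2000 * ((n : ℝ) * ((N : ℝ) * N)) := by ring
  calc 1 / 32000 * ((W : ℝ) ^ 2 * L) * Real.logb 2 (((W : ℝ) + 1) ^ L * B ^ L / (4 * ε))
      ≤ 1 / 32000 * ((W : ℝ) ^ 2 * L) * (2 * L * ℓ + κ) := by gcongr
    _ ≤ 1 / 32000 * (2000 * (n * (N * N))) * (2 * (8 * μ) * ℓ + 16 * κ) := by
        gcongr
        linarith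
    _ = n * (N * N) * (μ * ℓ + κ) := by ring
    _ ≤ n * (N * N) * Real.logb 2 ((Q : ℝ) + 1) := by gcongr

/-- The geometric parameters of a separated family: a cell size `h`, a spacing `w` and a grid
resolution `Q`. -/
theorem exists_grid_parameters {W L N n μ : ℕ} {B ε : ℝ} (hW : 60 ≤ W) (hL : 60 ≤ L)
    (hB : 1 ≤ B) (hε : 0 < ε) (hN1 : (1 : ℝ) ≤ N) (hn1 : (1 : ℝ) ≤ n)
    (hNW : 5 * (N : ℝ) ≤ W) (hnL : 10 * (n : ℝ) ≤ L) (hμ : μ = L / 4) :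
    ∃ (h w : ℝ) (Q : ℕ), 0 < h ∧ 0 < w ∧ w ≤ 1 ∧ 2 * N * h ≤ 1 ∧ 4 * (n * N + 1) * w = h ∧
      4 * Q * (5 * ε) < ((W : ℝ) * B) ^ (2 * μ) * w ^ 2 ∧
      ((W : ℝ) * B) ^ μ / (4 * ε) ≤ (Q : ℝ) + 1 := by
  have hW0 : (60 : ℝ) ≤ W := by exact_mod_cast hW
  have hnN : 1 ≤ (n : ℝ) * N := one_le_mul_of_one_le_of_one_le hn1 hN1
  set h : ℝ := 1 / (2 * N) with hh
  set D : ℝ := 8 * N * (n * N + 1) with hD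
  have hD0 : 1 ≤ D := by rw [hD]; nlinarith
  set w : ℝ := 1 / D with hw
  have hw0 : 0 < w := by positivity
  have hw1 : w ≤ 1 := by rw [hw, div_le_one (by linarith)]; exact hD0
  have hNh : 2 * N * h ≤ 1 := by rw [hh]; field_simp; rfl
  have hwh' : 4 * (n * N + 1) * w = h := by rw [hw, hD, hh]; field_simp; norm_num
  have hDW : D ≤ W ^ 2 * L / 15 := by
    have h1 : D ≤ 16 * (n * N ^ 2) := by rw [hD]; nlinarith
    have h2 : (5 * (N : ℝ)) ^ 2 * (10 * n) ≤ W ^ 2 * L := by gcongr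
    linarith
  set P : ℝ := ((W : ℝ) * B) ^ μ with hP
  have hPD : 10 * D ^ 2 ≤ P := by
    have h1 : D ^ 2 ≤ (W ^ 2 * L / 15 : ℝ) ^ 2 := by gcongr
    have h2 := pow_mul_sq_le hW hL
    rw [← hμ] at h2
    have h3 : (W : ℝ) ^ μ ≤ P := by
      rw [hP]; gcongr; exact le_mul_of_one_le_right (by linarith) hB
    have h4 : (0 : ℝ) ≤ W ^ 4 * L ^ 2 := by positivity
    nlinarith
  have hP0 : 0 < P := by positivity
  set A : ℝ := ((W : ℝ) * B) ^ (2 * μ) with hA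
  have hAP : A = P ^ 2 := by rw [hA, hP, ← pow_mul, mul_comm 2 μ]
  set Q : ℕ := ⌊A * w ^ 2 / (40 * ε)⌋₊ with hQ
  have hAw : 0 < A * w ^ 2 := by rw [hAP]; positivity
  have hQle : 4 * Q * (5 * ε) < A * w ^ 2 := by
    have h1 : (Q : ℝ) ≤ A * w ^ 2 / (40 * ε) := Nat.floor_le (by positivity)
    rw [le_div_iff₀ (by positivity)] at h1
    linarith
  have hQge : P / (4 * ε) ≤ (Q : ℝ) + 1 := by
    have h1 : P / (4 * ε) ≤ A * w ^ 2 / (40 * ε) := by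
      rw [div_le_div_iff₀ (by positivity) (by positivity), hAP, hw]
      have h2 : 10 * P ≤ P ^ 2 * (1 / D) ^ 2 := by
        rw [one_div, inv_pow, ← div_eq_mul_inv, le_div_iff₀ (by positivity)]
        nlinarith
      nlinarith
    exact h1.trans (Nat.lt_floor_add_one _).le
  exact ⟨h, w, Q, by positivity, hw0, hw1, hNh, hwh', hQle, hQge⟩

/-- The class `R(d,W,L,B)` contains large finite families that are separated at scale `5 * ε`. -/
theorem exists_separated_RclassB {d W L : ℕ} {B ε : ℝ} {p : ℝ≥0∞} (hp : 1 ≤ p) (hd : 0 < d)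
    (hdW : d ≤ W) (hW : 60 ≤ W) (hL : 60 ≤ L) (hB : 1 ≤ B) (hε : 0 < ε) (hε' : ε < 1 / 8) :
    ∃ (γ : Type) (_ : Fintype γ) (_ : Nonempty γ) (g : γ → (Fin d → ℝ) → ℝ),
      (∀ i, g i ∈ RclassB d W L B) ∧
      (∀ i j, i ≠ j → ENNReal.ofReal (5 * ε) < cubeDist d p (g i) (g j)) ∧
      1 / 32000 * ((W : ℝ) ^ 2 * L) * Real.logb 2 (((W : ℝ) + 1) ^ L * B ^ L / (4 * ε))
        ≤ Real.logb 2 (Fintype.card γ) := by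
  obtain ⟨N, hN⟩ : ∃ N, N = W / 5 := ⟨_, rfl⟩
  obtain ⟨n, hn⟩ : ∃ n, n = L / 10 := ⟨_, rfl⟩
  obtain ⟨μ, hμ⟩ : ∃ μ, μ = L / 4 := ⟨_, rfl⟩
  have hW0 : (60 : ℝ) ≤ W := by exact_mod_cast hW
  have hL0 : (60 : ℝ) ≤ L := by exact_mod_cast hL
  have hN1 : (1 : ℝ) ≤ N := by exact_mod_cast (by omega : 1 ≤ N)
  have hn1 : (1 : ℝ) ≤ n := by exact_mod_cast (by omega : 1 ≤ n)
  have hNW : 5 * (N : ℝ) ≤ W := by exact_mod_cast (by omega : 5 * N ≤ W)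
  have hWN : (W : ℝ) ≤ 10 * N := by exact_mod_cast (by omega : W ≤ 10 * N)
  have hnL : 10 * (n : ℝ) ≤ L := by exact_mod_cast (by omega : 10 * n ≤ L)
  have hLn : (L : ℝ) ≤ 20 * n := by exact_mod_cast (by omega : L ≤ 20 * n)
  have hLμ : (L : ℝ) ≤ 8 * μ := by exact_mod_cast (by omega : L ≤ 8 * μ)
  obtain ⟨h, w, Q, hh0, hw0, hw1, hNh, hwh', hQle, hQge⟩ :=
    exists_grid_parameters hW hL hB hε hN1 hn1 hNW hnL hμ
  have hwh : 4 * (n * N) * w ≤ h := by linarith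
  set A : ℝ := ((W : ℝ) * B) ^ (2 * μ) with hA
  have hmem : ∀ φ : Fin n × Fin N × Fin N → Fin (Q + 1),
      (fun x : Fin d → ℝ => A * cellFunction N n h w (gridParam φ) (x ⟨0, hd⟩))
        ∈ RclassB d W L B := fun φ =>
    amplified_cellFunction_mem_RclassB hd hdW hB (by omega) (by omega) (by positivity) hNh hw0.le
      hw1 (by nlinarith) (gridParam_mem_Icc φ)
  refine ⟨Fin n × Fin N × Fin N → Fin (Q + 1), inferInstance, inferInstance, _, hmem,
    fun φ ψ hne => ofReal_lt_cubeDist_amplified hp _ hw0 hwh hNh (by positivity) (by positivity)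
      hQle hne (continuous_of_mem_RclassB (hmem φ)) (continuous_of_mem_RclassB (hmem ψ)), ?_⟩
  have hcard : Fintype.card (Fin n × Fin N × Fin N → Fin (Q + 1)) = (Q + 1) ^ (n * (N * N)) := by
    simp
  rw [hcard]
  push_cast
  rw [Real.logb_pow]
  push_cast
  exact logb_le_mul_logb_of_grid hW0 hB hε hε' hWN hLn hLμ hQge

/-- An inequality between affine functions of `log (1/ε)` that holds for all small `ε` compares
the slopes. -/
theorem le_of_forall_logb_div_le {a b X Y : ℝ} (hX : 0 < X) (hY : 0 < Y)
    (h : ∀ ε : ℝ, 0 < ε → ε < 1 / 8 →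
      a * Real.logb 2 (X / (4 * ε)) ≤ b * Real.logb 2 (Y / ε)) : a ≤ b := by
  by_contra! hab
  set M := b * Real.logb 2 Y - a * (Real.logb 2 X - Real.logb 2 4) with hM
  set t := max 4 (M / (a - b) + 1) with ht
  have ht4 : 4 ≤ t := le_max_left _ _
  have htM : M / (a - b) < t := lt_of_lt_of_le (by linarith) (le_max_right _ _)
  rw [div_lt_iff₀ (by linarith)] at htM
  have hpos : (0 : ℝ) < 2 ^ (-t) := by positivity
  have hlt : (2 : ℝ) ^ (-t) < 1 / 8 := by
    have h1 : (2 : ℝ) ^ (-t) < 2 ^ (-3 : ℝ) :=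
      Real.rpow_lt_rpow_of_exponent_lt (by norm_num) (by linarith)
    refine h1.trans_le ?_
    rw [Real.rpow_neg (by norm_num)]
    norm_num
  have h1 := h _ hpos hlt
  rw [Real.logb_div hX.ne' (by positivity), Real.logb_div hY.ne' hpos.ne',
    Real.logb_mul (by norm_num) hpos.ne', Real.logb_rpow (by norm_num) (by norm_num)] at h1
  linarith

/-- Fundamental limits of neural network transformation: whenever the
class `R(d,W̃,L̃,B̃)` approximates the class `R(d,W,L,B)` to within `ε ∈ (0,1/8)` in
`L^p([0,1]^d)`, the inequality
`c·W²L·log((W+1)^L B^L/(4ε)) ≤ C·W̃²L̃·log((W̃+1)^L̃ B̃^L̃/ε)` must hold; in particular, if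
`R(d,W,L,B) ⊆ R(d,W̃,L̃,B̃)` then `C·W̃²L̃ ≥ c·W²L`. -/
theorem network_transformation_limits :
    ∃ c C : ℝ, 0 < c ∧ 0 < C ∧
      ∀ (p : ℝ≥0∞) (d W L Wt Lt : ℕ) (B Bt : ℝ),
        1 ≤ p → 0 < d → d ≤ W → d ≤ Wt → 0 < Lt → 60 ≤ W → 60 ≤ L →
        1 ≤ B → 1 ≤ Bt →
        (∀ ε : ℝ, 0 < ε → ε < 1 / 8 →
          minimaxErr (RclassB d W L B) (RclassB d Wt Lt Bt) (cubeDist d p)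
              ≤ ENNReal.ofReal ε →
          c * ((W : ℝ) ^ 2 * L) * Real.logb 2 (((W : ℝ) + 1) ^ L * B ^ L / (4 * ε))
            ≤ C * ((Wt : ℝ) ^ 2 * Lt) *
                Real.logb 2 (((Wt : ℝ) + 1) ^ Lt * Bt ^ Lt / ε))
        ∧ (RclassB d W L B ⊆ RclassB d Wt Lt Bt →
            c * ((W : ℝ) ^ 2 * L) ≤ C * ((Wt : ℝ) ^ 2 * Lt)) := by
  refine ⟨1 / 32000, 12, by norm_num, by norm_num, ?_⟩
  intro p d W L Wt Lt B Bt hp hd hdW hdWt hLt hW hL hB hBt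
  have key : ∀ ε : ℝ, 0 < ε → ε < 1 / 8 →
      minimaxErr (RclassB d W L B) (RclassB d Wt Lt Bt) (cubeDist d p) ≤ ENNReal.ofReal ε →
      1 / 32000 * ((W : ℝ) ^ 2 * L) * Real.logb 2 (((W : ℝ) + 1) ^ L * B ^ L / (4 * ε))
        ≤ 12 * ((Wt : ℝ) ^ 2 * Lt) * Real.logb 2 (((Wt : ℝ) + 1) ^ Lt * Bt ^ Lt / ε) := by
    intro ε hε hε' hA
    obtain ⟨γ, _, _, g, hg, hsep, hcard⟩ :=
      exists_separated_RclassB hp hd hdW hW hL hB hε hε'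
    exact hcard.trans (logb_card_le_of_minimaxErr_le hp (hd.trans_le hdWt) hLt hBt hε hε' hA hg
      (fun i => continuous_of_mem_RclassB (hg i)) hsep)
  refine ⟨key, fun hsub => ?_⟩
  refine le_of_forall_logb_div_le (X := ((W : ℝ) + 1) ^ L * B ^ L)
    (Y := ((Wt : ℝ) + 1) ^ Lt * Bt ^ Lt) (by positivity) (by positivity)
    fun ε hε hε' => key ε hε hε' ?_
  refine iSup₂_le fun f hf => (iInf₂_le f (hsub hf)).trans ?_
  simp [cubeDist]
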